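/- Let 0 < ξ < 1/20 and let H be a graph on p vertices with minimum degree at least (2/3 − ξ)·p. Let N ⊆ V(H) with |N| = ⌈(2/3 − 2ξ)·p⌉. Then there is a set X ⊆ V(H) with |X| ≤ ⌊15ξp⌋ + 1 such that H − X admits an (N \ X)-out-good path partition, i.e., a collection of vertex-disjoint paths covering all vertices of H − X, each path P being either an edge AB with A,B ∈ N \ X, or a path ABCD with B,C ∈ N \ X, or a path ABCDEF with B,C,D,E ∈ N \ X. -/

import Mathlib

/-- A list of vertices has the shape required for a member of an `N`-out-good
path partition: a 2-vertex path with both ends in `N`, a 4-vertex path whose two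
internal vertices are in `N`, or a 6-vertex path whose four internal vertices are
in `N`. -/
def OutGood {V : Type*} (N : Set V) (l : List V) : Prop :=
  (∃ a b, l = [a, b] ∧ a ∈ N ∧ b ∈ N) ∨
  (∃ a b c d, l = [a, b, c, d] ∧ b ∈ N ∧ c ∈ N) ∨
  (∃ a b c d e f, l = [a, b, c, d, e, f] ∧ b ∈ N ∧ c ∈ N ∧ d ∈ N ∧ e ∈ N)

open Multiset in
lemma o_count_bound {V α : Type*} (f : α → Multiset V) (p q : V → Prop) [DecidablePred p]
    [DecidablePred q] (c k : ℕ) (S : Multiset α)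
    (h : ∀ a ∈ S, c * (countP p (f a) + countP q (f a)) ≤ k * card (f a)) :
    c * (countP p (S.map f).sum + countP q (S.map f).sum) ≤ k * card (S.map f).sum := by
  induction S using Multiset.induction with
  | empty => simp
  | cons a S ih =>
    have h1 := h a (by simp)
    have h2 := ih (fun b hb => h b (by simp [hb]))
    simp only [map_cons, sum_cons, countP_add, card_add]
    nlinarith

open Multiset in
lemma o_card_const {V α : Type*} (f : α → Multiset V) (k : ℕ) (S : Multiset α)
    (h : ∀ a, card (f a) = k) : card (S.map f).sum = k * card S := by
  induction S using Multiset.induction with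
  | empty => simp
  | cons a S ih =>
    simp only [map_cons, sum_cons, card_add, h, ih, card_cons]; ring

/-- choose a multiset-type state minimising a measure -/
lemma o_min {α : Type*} (P : α → Prop) (m : α → ℕ) (h : ∃ a, P a) :
    ∃ a, P a ∧ ∀ b, P b → m a ≤ m b := by
  classical
  obtain ⟨a, ha, hm⟩ := WellFounded.has_min (measure m).wf {a | P a} h
  exact ⟨a, ha, fun b hb => not_lt.1 (hm b hb)⟩

/-- Stage 1: large matchings. -/
lemma o_stage1 {V : Type*} [DecidableEq V] (H : SimpleGraph V) [DecidableRel H.Adj]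
    (A : Multiset V) (k : ℕ) (hk : ∀ v ∈ A, k ≤ Multiset.countP (H.Adj v) A) :
    ∃ (M : Multiset (V × V)) (U : Multiset V),
      (∀ e ∈ M, H.Adj e.1 e.2) ∧
      (M.map (fun e => ({e.1, e.2} : Multiset V))).sum + U = A ∧
      (U.card ≤ 1 ∨ 2 * k + U.card ≤ A.card) := by
  obtain ⟨⟨M, U⟩, ⟨hM, hA⟩, hmin⟩ := o_min
    (fun s : Multiset (V × V) × Multiset V => (∀ e ∈ s.1, H.Adj e.1 e.2) ∧
      (s.1.map (fun e => ({e.1, e.2} : Multiset V))).sum + s.2 = A) (fun s => s.2.card)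
    ⟨(0, A), by simp⟩
  dsimp only at hM hA hmin
  refine ⟨M, U, hM, hA, ?_⟩
  by_contra hcon
  push Not at hcon
  obtain ⟨hU, hk2⟩ := hcon
  obtain ⟨u1, hu1⟩ := Multiset.card_pos_iff_exists_mem.1 (by omega : 0 < U.card)
  obtain ⟨U1, rfl⟩ := Multiset.exists_cons_of_mem hu1
  obtain ⟨u2, hu2⟩ := Multiset.card_pos_iff_exists_mem.1
    (by simp only [Multiset.card_cons] at hU; omega : 0 < U1.card)
  obtain ⟨U2, rfl⟩ := Multiset.exists_cons_of_mem hu2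
  -- no edges among U
  have hind : ∀ a b W, u1 ::ₘ u2 ::ₘ U2 = a ::ₘ b ::ₘ W → ¬ H.Adj a b := by
    intro a b W hW hab
    have := hmin ((a, b) ::ₘ M, W) ⟨by
      intro e he
      rcases Multiset.mem_cons.1 he with rfl | he
      · exact hab
      · exact hM e he, by
      rw [← hA, hW]
      simp only [Multiset.map_cons, Multiset.sum_cons]
      simp only [← Multiset.singleton_add, Multiset.insert_eq_cons]
      abel⟩
    rw [hW] at this
    simp only [Multiset.card_cons] at this
    omega
  have h12 := hind u1 u2 U2 rfl
  have h1U : ∀ w ∈ U2, ¬ H.Adj u1 w := by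
    intro w hw
    obtain ⟨W, rfl⟩ := Multiset.exists_cons_of_mem hw
    exact hind u1 w (u2 ::ₘ W) (by rw [Multiset.cons_swap u2 w])
  have h2U : ∀ w ∈ U2, ¬ H.Adj u2 w := by
    intro w hw
    obtain ⟨W, rfl⟩ := Multiset.exists_cons_of_mem hw
    exact hind u2 w (u1 ::ₘ W) (by rw [Multiset.cons_swap u1 u2, Multiset.cons_swap u1 w])
  have hpair : ∀ e ∈ M, 1 * (Multiset.countP (H.Adj u1) ({e.1, e.2} : Multiset V) +
      Multiset.countP (H.Adj u2) ({e.1, e.2} : Multiset V)) ≤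
      1 * Multiset.card ({e.1, e.2} : Multiset V) := by
    rintro ⟨x, y⟩ he
    obtain ⟨M', rfl⟩ := Multiset.exists_cons_of_mem he
    have hxy : ∀ a b, ({a, b} : Multiset V) = {x, y} → ¬ (H.Adj u1 a ∧ H.Adj u2 b) := by
      rintro a b hab ⟨h1, h2⟩
      have := hmin ((u1, a) ::ₘ (u2, b) ::ₘ M', U2) ⟨by
        intro e he
        simp only [Multiset.mem_cons] at he
        rcases he with rfl | rfl | he
        · exact h1
        · exact h2
        · exact hM e (by simp [he]), by
        rw [← hA]
        simp only [Multiset.map_cons, Multiset.sum_cons, ← hab]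
        simp only [← Multiset.singleton_add, Multiset.insert_eq_cons]
        abel⟩
      simp only [Multiset.card_cons] at this
      omega
    have ha := hxy x y rfl
    have hb := hxy y x (Multiset.pair_comm _ _)
    simp only [Multiset.insert_eq_cons, ← Multiset.cons_zero, Multiset.countP_cons,
      Multiset.card_cons, Multiset.countP_zero, Multiset.card_zero]
    by_cases hc1 : H.Adj u1 x <;> by_cases hc2 : H.Adj u1 y <;> by_cases hc3 : H.Adj u2 x <;>
      by_cases hc4 : H.Adj u2 y <;> simp_all
  have hb := o_count_bound _ _ _ _ _ M hpair
  have e1 := hk u1 (by rw [← hA]; simp)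
  have e2 := hk u2 (by rw [← hA]; simp)
  have z1 : Multiset.countP (H.Adj u1) U2 = 0 := Multiset.countP_eq_zero.2 h1U
  have z2 : Multiset.countP (H.Adj u2) U2 = 0 := Multiset.countP_eq_zero.2 h2U
  have h21 : ¬ H.Adj u2 u1 := fun h => h12 h.symm
  rw [← hA] at e1 e2 hk2
  simp only [Multiset.countP_add, Multiset.countP_cons, z1, z2, h12, h21, SimpleGraph.irrefl,
    Multiset.card_add, Multiset.card_cons, if_false] at e1 e2 hk2
  omega

/-- Stage 2: attach the outside vertices greedily to matching edges. -/
lemma o_stage2 {V : Type*} [DecidableEq V] (H : SimpleGraph V) [DecidableRel H.Adj]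
    (E0 : Multiset (V × V)) (hE0 : ∀ e ∈ E0, H.Adj e.1 e.2) (W0 : Multiset V) (k : ℕ)
    (hk : ∀ v ∈ W0, k ≤ Multiset.countP (H.Adj v)
      (E0.map (fun e => ({e.1, e.2} : Multiset V))).sum) :
    ∃ (E : Multiset (V × V)) (T : Multiset (V × V × V)) (F : Multiset (V × V × V × V))
      (W : Multiset V),
      (∀ e ∈ E, H.Adj e.1 e.2) ∧
      (∀ t ∈ T, H.Adj t.1 t.2.1 ∧ H.Adj t.2.1 t.2.2) ∧
      (∀ t ∈ F, H.Adj t.1 t.2.1 ∧ H.Adj t.2.1 t.2.2.1 ∧ H.Adj t.2.2.1 t.2.2.2) ∧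
      (E.map (fun e => ({e.1, e.2} : Multiset V))).sum +
        (T.map (fun e => ({e.2.1, e.2.2} : Multiset V))).sum +
        (F.map (fun e => ({e.2.1, e.2.2.1} : Multiset V))).sum =
        (E0.map (fun e => ({e.1, e.2} : Multiset V))).sum ∧
      (T.map (fun e => ({e.1} : Multiset V))).sum +
        (F.map (fun e => ({e.1, e.2.2.2} : Multiset V))).sum + W = W0 ∧
      (W.card = 0 ∨ k + W.card ≤ W0.card) := by
  obtain ⟨⟨E, T, F, W⟩, ⟨hE, hT, hF, hA, hB⟩, hmin⟩ := o_min
    (fun s : Multiset (V × V) × Multiset (V × V × V) × Multiset (V × V × V × V) × Multiset V =>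
      (∀ e ∈ s.1, H.Adj e.1 e.2) ∧
      (∀ t ∈ s.2.1, H.Adj t.1 t.2.1 ∧ H.Adj t.2.1 t.2.2) ∧
      (∀ t ∈ s.2.2.1, H.Adj t.1 t.2.1 ∧ H.Adj t.2.1 t.2.2.1 ∧ H.Adj t.2.2.1 t.2.2.2) ∧
      (s.1.map (fun e => ({e.1, e.2} : Multiset V))).sum +
        (s.2.1.map (fun e => ({e.2.1, e.2.2} : Multiset V))).sum +
        (s.2.2.1.map (fun e => ({e.2.1, e.2.2.1} : Multiset V))).sum =
        (E0.map (fun e => ({e.1, e.2} : Multiset V))).sum ∧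
      (s.2.1.map (fun e => ({e.1} : Multiset V))).sum +
        (s.2.2.1.map (fun e => ({e.1, e.2.2.2} : Multiset V))).sum + s.2.2.2 = W0)
    (fun s => s.2.2.2.card)
    ⟨(E0, 0, 0, W0), by simpa using hE0⟩
  dsimp only at hE hT hF hA hB hmin
  refine ⟨E, T, F, W, hE, hT, hF, hA, hB, ?_⟩
  by_contra hcon
  push Not at hcon
  obtain ⟨hW, hk2⟩ := hcon
  obtain ⟨r, hr⟩ := Multiset.card_pos_iff_exists_mem.1 (by omega : 0 < W.card)
  obtain ⟨W', rfl⟩ := Multiset.exists_cons_of_mem hr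
  have hE' : ∀ e ∈ E, 1 * (Multiset.countP (H.Adj r) ({e.1, e.2} : Multiset V) +
      Multiset.countP (H.Adj r) ({e.1, e.2} : Multiset V)) ≤
      0 * Multiset.card ({e.1, e.2} : Multiset V) := by
    rintro ⟨x, y⟩ he
    have hxy := hE _ he
    obtain ⟨E', rfl⟩ := Multiset.exists_cons_of_mem he
    have key : ∀ a b, ({a, b} : Multiset V) = {x, y} → H.Adj a b → ¬ H.Adj r a := by
      intro a b hab hadj h1
      have := hmin (E', (r, a, b) ::ₘ T, F, W') ⟨fun e he => hE e (by simp [he]), by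
        intro e he
        rcases Multiset.mem_cons.1 he with rfl | he
        · exact ⟨h1, hadj⟩
        · exact hT e he, hF, by
        rw [← hA]
        simp only [Multiset.map_cons, Multiset.sum_cons, ← hab]
        abel, by
        rw [← hB]
        simp only [Multiset.map_cons, Multiset.sum_cons]
        simp only [← Multiset.singleton_add, Multiset.insert_eq_cons]
        abel⟩
      simp only [Multiset.card_cons] at this
      omega
    have k1 := key x y rfl hxy
    have k2 := key y x (Multiset.pair_comm _ _) hxy.symm
    simp [Multiset.insert_eq_cons, ← Multiset.cons_zero, k1, k2]
  have hT' : ∀ e ∈ T, 1 * (Multiset.countP (H.Adj r) ({e.2.1, e.2.2} : Multiset V) +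
      Multiset.countP (H.Adj r) ({e.2.1, e.2.2} : Multiset V)) ≤
      1 * Multiset.card ({e.2.1, e.2.2} : Multiset V) := by
    rintro ⟨s, x, y⟩ he
    have hxy := hT _ he
    obtain ⟨T', rfl⟩ := Multiset.exists_cons_of_mem he
    have key : ¬ H.Adj r y := by
      intro h1
      have := hmin (E, T', (s, x, y, r) ::ₘ F, W') ⟨hE, fun e he => hT e (by simp [he]), by
        intro e he
        rcases Multiset.mem_cons.1 he with rfl | he
        · exact ⟨hxy.1, hxy.2, h1.symm⟩
        · exact hF e he, by
        rw [← hA]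
        simp only [Multiset.map_cons, Multiset.sum_cons]
        abel, by
        rw [← hB]
        simp only [Multiset.map_cons, Multiset.sum_cons]
        simp only [← Multiset.singleton_add, Multiset.insert_eq_cons]
        abel⟩
      simp only [Multiset.card_cons] at this
      omega
    simp only [Multiset.insert_eq_cons, ← Multiset.cons_zero, Multiset.countP_cons,
      Multiset.card_cons, Multiset.countP_zero, Multiset.card_zero, key, if_false]
    split_ifs <;> omega
  have b1 := o_count_bound _ _ _ _ _ E hE'
  have b2 := o_count_bound _ _ _ _ _ T hT'
  have b3 := Multiset.countP_le_card (H.Adj r)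
    ((F.map (fun e => ({e.2.1, e.2.2.1} : Multiset V))).sum)
  have c1 := o_card_const (fun e : V × V × V => ({e.2.1, e.2.2} : Multiset V)) 2 T (by simp)
  have c2 := o_card_const (fun e : V × V × V × V => ({e.2.1, e.2.2.1} : Multiset V)) 2 F (by simp)
  have c3 := o_card_const (fun e : V × V × V => ({e.1} : Multiset V)) 1 T (by simp)
  have c4 := o_card_const (fun e : V × V × V × V => ({e.1, e.2.2.2} : Multiset V)) 2 F (by simp)
  have e1 := hk r (by rw [← hB]; simp)
  rw [← hA] at e1
  rw [← hB] at hk2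
  simp only [Multiset.countP_add, Multiset.card_add, Multiset.card_cons] at e1 hk2
  omega

/-- The state used for the last stage. -/
structure OState {V : Type*} [Fintype V] (H : SimpleGraph V) (N : Finset V)
    (C : Multiset (List V)) (T : Multiset (V × V × V)) (G : Multiset V) : Prop where
  hC : ∀ l ∈ C, l.IsChain H.Adj ∧ OutGood (↑N) l
  hT : ∀ t ∈ T, t.2.1 ∈ N ∧ t.2.2 ∈ N ∧ H.Adj t.1 t.2.1 ∧ H.Adj t.2.1 t.2.2
  hS : (C.map (fun l : List V => (l : Multiset V))).sum +
    (T.map (fun t => ({t.1, t.2.1, t.2.2} : Multiset V))).sum + G = Finset.univ.val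

lemma o_good2 {V : Type*} {H : SimpleGraph V} {N : Finset V} {a b : V} (ha : a ∈ N) (hb : b ∈ N)
    (h : H.Adj a b) : [a, b].IsChain H.Adj ∧ OutGood (↑N) [a, b] :=
  ⟨by simp [h], Or.inl ⟨a, b, rfl, by simpa using ha, by simpa using hb⟩⟩

lemma o_good4 {V : Type*} {H : SimpleGraph V} {N : Finset V} {a b c d : V} (hb : b ∈ N)
    (hc : c ∈ N) (h1 : H.Adj a b) (h2 : H.Adj b c) (h3 : H.Adj c d) :
    [a, b, c, d].IsChain H.Adj ∧ OutGood (↑N) [a, b, c, d] :=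
  ⟨by simp [h1, h2, h3], Or.inr (Or.inl ⟨a, b, c, d, rfl, by simpa using hb, by simpa using hc⟩)⟩

lemma o_good6 {V : Type*} {H : SimpleGraph V} {N : Finset V} {a b c d e f : V} (hb : b ∈ N)
    (hc : c ∈ N) (hd : d ∈ N) (he : e ∈ N) (h1 : H.Adj a b) (h2 : H.Adj b c) (h3 : H.Adj c d)
    (h4 : H.Adj d e) (h5 : H.Adj e f) :
    [a, b, c, d, e, f].IsChain H.Adj ∧ OutGood (↑N) [a, b, c, d, e, f] :=
  ⟨by simp [h1, h2, h3, h4, h5], Or.inr (Or.inr ⟨a, b, c, d, e, f, rfl, by simpa using hb,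
    by simpa using hc, by simpa using hd, by simpa using he⟩)⟩

/-- Two triples and a good piece: either they can be repartitioned into good pieces, or the
two free ends send few edges to the piece. -/
lemma o_piece {V : Type*} (H : SimpleGraph V) [DecidableRel H.Adj] (N : Finset V)
    (r A B s A' B' : V) (hA : A ∈ N) (hB : B ∈ N) (hA' : A' ∈ N) (hB' : B' ∈ N)
    (h1 : H.Adj r A) (h2 : H.Adj A B) (h3 : H.Adj s A') (h4 : H.Adj A' B')
    (l : List V) (hl : l.IsChain H.Adj) (hg : OutGood (↑N) l)
    (hno : ∀ D : List (List V), (∀ x ∈ D, x.IsChain H.Adj ∧ OutGood (↑N) x) →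
      (D.map (fun l : List V => (l : Multiset V))).sum ≠ {r, A, B} + {s, A', B'} + (l : Multiset V)) :
    3 * (Multiset.countP (H.Adj B) (l : Multiset V) +
      Multiset.countP (H.Adj B') (l : Multiset V)) ≤ 4 * Multiset.card (l : Multiset V) := by
  rcases hg with ⟨x, y, rfl, hx, hy⟩ | ⟨a, x, y, d, rfl, hx, hy⟩ |
    ⟨a, b, c, d, e, f, rfl, hb, hc, hd, he⟩
  · have k1 : ¬ (H.Adj B x ∧ H.Adj B' y) := by
      rintro ⟨g1, g2⟩
      refine hno [[r, A, B, x], [s, A', B', y]] ?_ ?_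
      · simp only [List.forall_mem_cons]
        exact ⟨o_good4 hA hB h1 h2 g1, o_good4 hA' hB' h3 h4 g2, by simp⟩
      · simp only [List.map_cons, List.sum_cons, List.map_nil, List.sum_nil, ← Multiset.cons_coe,
          ← Multiset.singleton_add, Multiset.insert_eq_cons, Multiset.coe_nil]
        abel
    have k2 : ¬ (H.Adj B y ∧ H.Adj B' x) := by
      rintro ⟨g1, g2⟩
      refine hno [[r, A, B, y], [s, A', B', x]] ?_ ?_
      · simp only [List.forall_mem_cons]
        exact ⟨o_good4 hA hB h1 h2 g1, o_good4 hA' hB' h3 h4 g2, by simp⟩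
      · simp only [List.map_cons, List.sum_cons, List.map_nil, List.sum_nil, ← Multiset.cons_coe,
          ← Multiset.singleton_add, Multiset.insert_eq_cons, Multiset.coe_nil]
        abel
    simp only [← Multiset.cons_coe, Multiset.countP_cons, Multiset.card_cons, Multiset.coe_nil,
      Multiset.countP_zero, Multiset.card_zero]
    split_ifs <;> first | omega | (exfalso; tauto)
  · have hx' : x ∈ N := by simpa using hx
    have hy' : y ∈ N := by simpa using hy
    simp only [List.isChain_cons_cons, List.isChain_singleton, and_true] at hl
    obtain ⟨l1, l2, l3⟩ := hl
    have q1 : ¬ (H.Adj B x ∧ H.Adj B' a) := by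
      rintro ⟨g1, g2⟩
      refine hno [[r, A, B, x, y, d], [s, A', B', a]] ?_ ?_
      · simp only [List.forall_mem_cons]
        exact ⟨o_good6 hA hB hx' hy' h1 h2 g1 l2 l3, o_good4 hA' hB' h3 h4 g2, by simp⟩
      · simp only [List.map_cons, List.sum_cons, List.map_nil, List.sum_nil, ← Multiset.cons_coe,
          ← Multiset.singleton_add, Multiset.insert_eq_cons, Multiset.coe_nil]
        abel
    have q2 : ¬ (H.Adj B y ∧ H.Adj B' d) := by
      rintro ⟨g1, g2⟩
      refine hno [[r, A, B, y, x, a], [s, A', B', d]] ?_ ?_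
      · simp only [List.forall_mem_cons]
        exact ⟨o_good6 hA hB hy' hx' h1 h2 g1 l2.symm l1.symm, o_good4 hA' hB' h3 h4 g2, by simp⟩
      · simp only [List.map_cons, List.sum_cons, List.map_nil, List.sum_nil, ← Multiset.cons_coe,
          ← Multiset.singleton_add, Multiset.insert_eq_cons, Multiset.coe_nil]
        abel
    have q3 : ¬ (H.Adj B' x ∧ H.Adj B a) := by
      rintro ⟨g1, g2⟩
      refine hno [[s, A', B', x, y, d], [r, A, B, a]] ?_ ?_
      · simp only [List.forall_mem_cons]
        exact ⟨o_good6 hA' hB' hx' hy' h3 h4 g1 l2 l3, o_good4 hA hB h1 h2 g2, by simp⟩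
      · simp only [List.map_cons, List.sum_cons, List.map_nil, List.sum_nil, ← Multiset.cons_coe,
          ← Multiset.singleton_add, Multiset.insert_eq_cons, Multiset.coe_nil]
        abel
    have q4 : ¬ (H.Adj B' y ∧ H.Adj B d) := by
      rintro ⟨g1, g2⟩
      refine hno [[s, A', B', y, x, a], [r, A, B, d]] ?_ ?_
      · simp only [List.forall_mem_cons]
        exact ⟨o_good6 hA' hB' hy' hx' h3 h4 g1 l2.symm l1.symm, o_good4 hA hB h1 h2 g2, by simp⟩
      · simp only [List.map_cons, List.sum_cons, List.map_nil, List.sum_nil, ← Multiset.cons_coe,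
          ← Multiset.singleton_add, Multiset.insert_eq_cons, Multiset.coe_nil]
        abel
    have w : ∀ p q : Prop, ∀ [Decidable p] [Decidable q], ¬ (p ∧ q) →
        (if p then 1 else 0) + (if q then 1 else 0) ≤ 1 := by
      intro p q _ _ h
      split_ifs <;> first | omega | (exfalso; tauto)
    have w1 := w _ _ q1
    have w2 := w _ _ q2
    have w3 := w _ _ q3
    have w4 := w _ _ q4
    simp only [← Multiset.cons_coe, Multiset.countP_cons, Multiset.card_cons, Multiset.coe_nil,
      Multiset.countP_zero, Multiset.card_zero]
    linarith
  · have hb' : b ∈ N := by simpa using hb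
    have hc' : c ∈ N := by simpa using hc
    have hd' : d ∈ N := by simpa using hd
    have he' : e ∈ N := by simpa using he
    simp only [List.isChain_cons_cons, List.isChain_singleton, and_true] at hl
    obtain ⟨l1, l2, l3, l4, l5⟩ := hl
    have q1 : ¬ (H.Adj B c ∧ H.Adj B' f) := by
      rintro ⟨g1, g2⟩
      refine hno [[r, A, B, c, b, a], [s, A', B', f], [d, e]] ?_ ?_
      · simp only [List.forall_mem_cons]
        exact ⟨o_good6 hA hB hc' hb' h1 h2 g1 l2.symm l1.symm, o_good4 hA' hB' h3 h4 g2,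
          o_good2 hd' he' l4, by simp⟩
      · simp only [List.map_cons, List.sum_cons, List.map_nil, List.sum_nil, ← Multiset.cons_coe,
          ← Multiset.singleton_add, Multiset.insert_eq_cons, Multiset.coe_nil]
        abel
    have q2 : ¬ (H.Adj B d ∧ H.Adj B' a) := by
      rintro ⟨g1, g2⟩
      refine hno [[r, A, B, d, e, f], [s, A', B', a], [b, c]] ?_ ?_
      · simp only [List.forall_mem_cons]
        exact ⟨o_good6 hA hB hd' he' h1 h2 g1 l4 l5, o_good4 hA' hB' h3 h4 g2,
          o_good2 hb' hc' l2, by simp⟩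
      · simp only [List.map_cons, List.sum_cons, List.map_nil, List.sum_nil, ← Multiset.cons_coe,
          ← Multiset.singleton_add, Multiset.insert_eq_cons, Multiset.coe_nil]
        abel
    have q3 : ¬ (H.Adj B' c ∧ H.Adj B f) := by
      rintro ⟨g1, g2⟩
      refine hno [[s, A', B', c, b, a], [r, A, B, f], [d, e]] ?_ ?_
      · simp only [List.forall_mem_cons]
        exact ⟨o_good6 hA' hB' hc' hb' h3 h4 g1 l2.symm l1.symm, o_good4 hA hB h1 h2 g2,
          o_good2 hd' he' l4, by simp⟩
      · simp only [List.map_cons, List.sum_cons, List.map_nil, List.sum_nil, ← Multiset.cons_coe,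
          ← Multiset.singleton_add, Multiset.insert_eq_cons, Multiset.coe_nil]
        abel
    have q4 : ¬ (H.Adj B' d ∧ H.Adj B a) := by
      rintro ⟨g1, g2⟩
      refine hno [[s, A', B', d, e, f], [r, A, B, a], [b, c]] ?_ ?_
      · simp only [List.forall_mem_cons]
        exact ⟨o_good6 hA' hB' hd' he' h3 h4 g1 l4 l5, o_good4 hA hB h1 h2 g2,
          o_good2 hb' hc' l2, by simp⟩
      · simp only [List.map_cons, List.sum_cons, List.map_nil, List.sum_nil, ← Multiset.cons_coe,
          ← Multiset.singleton_add, Multiset.insert_eq_cons, Multiset.coe_nil]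
        abel
    have w : ∀ p q : Prop, ∀ [Decidable p] [Decidable q], ¬ (p ∧ q) →
        (if p then 1 else 0) + (if q then 1 else 0) ≤ 1 := by
      intro p q _ _ h
      split_ifs <;> first | omega | (exfalso; tauto)
    have w0 : ∀ p : Prop, ∀ [Decidable p], (if p then 1 else 0) ≤ 1 := by
      intro p _
      split_ifs <;> omega
    have w1 := w _ _ q1
    have w2 := w _ _ q2
    have w3 := w _ _ q3
    have w4 := w _ _ q4
    have w5 := w0 (H.Adj B b)
    have w6 := w0 (H.Adj B e)
    have w7 := w0 (H.Adj B' b)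
    have w8 := w0 (H.Adj B' e)
    simp only [← Multiset.cons_coe, Multiset.countP_cons, Multiset.card_cons, Multiset.coe_nil,
      Multiset.countP_zero, Multiset.card_zero]
    linarith

/-- Stage 3: reduce the number of triples. -/
lemma o_stage3 {V : Type*} [Fintype V] [DecidableEq V] (H : SimpleGraph V) [DecidableRel H.Adj]
    (N : Finset V) (g0 : ℕ) (C0 : Multiset (List V)) (T0 : Multiset (V × V × V)) (G0 : Multiset V)
    (h0 : OState H N C0 T0 G0) (hg0 : G0.card ≤ g0) (k : ℕ)
    (hk : ∀ v, k ≤ Multiset.countP (H.Adj v) (Finset.univ : Finset V).val) :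
    ∃ (C : Multiset (List V)) (T : Multiset (V × V × V)) (G : Multiset V),
      OState H N C T G ∧ G.card ≤ g0 ∧
      (T.card ≤ 1 ∨ 6 * k + 6 * T.card + 4 * G.card ≤ 4 * Fintype.card V + 6) := by
  obtain ⟨⟨C, T, G⟩, ⟨hst, hG⟩, hmin⟩ := o_min
    (fun s : Multiset (List V) × Multiset (V × V × V) × Multiset V =>
      OState H N s.1 s.2.1 s.2.2 ∧ s.2.2.card ≤ g0) (fun s => s.2.1.card)
    ⟨(C0, T0, G0), h0, hg0⟩
  dsimp only at hst hG hmin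
  refine ⟨C, T, G, hst, hG, ?_⟩
  by_cases hT1 : T.card ≤ 1
  · exact Or.inl hT1
  right
  obtain ⟨⟨r, A, B⟩, hu1⟩ := Multiset.card_pos_iff_exists_mem.1 (by omega : 0 < T.card)
  obtain ⟨T1, rfl⟩ := Multiset.exists_cons_of_mem hu1
  obtain ⟨⟨s, A', B'⟩, hu2⟩ := Multiset.card_pos_iff_exists_mem.1
    (by simp only [Multiset.card_cons] at hT1; omega : 0 < T1.card)
  obtain ⟨T2, rfl⟩ := Multiset.exists_cons_of_mem hu2
  -- garbage
  have hgar : ∀ t T', (r, A, B) ::ₘ (s, A', B') ::ₘ T2 = t ::ₘ T' →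
      ∀ v ∈ G, ¬ H.Adj t.2.2 v := by
    rintro ⟨x, y, z⟩ T' hTT v hv hadj
    have hst' := hst
    rw [hTT] at hst'
    obtain ⟨G', rfl⟩ := Multiset.exists_cons_of_mem hv
    have ht := hst'.hT (x, y, z) (by simp)
    have := hmin ([x, y, z, v] ::ₘ C, T', G') ⟨⟨by
      intro l hl
      rcases Multiset.mem_cons.1 hl with rfl | hl
      · exact o_good4 ht.1 ht.2.1 ht.2.2.1 ht.2.2.2 hadj
      · exact hst.hC l hl, fun t h => hst'.hT t (by simp [h]), by
      rw [← hst'.hS]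
      simp only [Multiset.map_cons, Multiset.sum_cons]
      simp only [← Multiset.cons_coe, ← Multiset.singleton_add, Multiset.insert_eq_cons,
        Multiset.coe_nil]
      abel⟩, by simp only [Multiset.card_cons] at hG; dsimp only; omega⟩
    rw [hTT] at this
    simp only [Multiset.card_cons] at this
    omega
  -- two triples
  have hpair : ∀ t t' T', (r, A, B) ::ₘ (s, A', B') ::ₘ T2 = t ::ₘ t' ::ₘ T' →
      ¬ H.Adj t.2.2 t'.2.2 ∧ ¬ H.Adj t.2.2 t'.1 := by
    rintro ⟨x, y, z⟩ ⟨x', y', z'⟩ T' hTT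
    have hst' := hst
    rw [hTT] at hst'
    have ht := hst'.hT (x, y, z) (by simp)
    have ht' := hst'.hT (x', y', z') (by simp)
    refine ⟨fun hadj => ?_, fun hadj => ?_⟩
    · have := hmin ([x, y, z, z', y', x'] ::ₘ C, T', G) ⟨⟨by
        intro l hl
        rcases Multiset.mem_cons.1 hl with rfl | hl
        · exact o_good6 ht.1 ht.2.1 ht'.2.1 ht'.1 ht.2.2.1 ht.2.2.2 hadj ht'.2.2.2.symm
            ht'.2.2.1.symm
        · exact hst.hC l hl, fun t h => hst'.hT t (by simp [h]), by
        rw [← hst'.hS]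
        simp only [Multiset.map_cons, Multiset.sum_cons]
        simp only [← Multiset.cons_coe, ← Multiset.singleton_add, Multiset.insert_eq_cons,
          Multiset.coe_nil]
        abel⟩, hG⟩
      rw [hTT] at this
      simp only [Multiset.card_cons] at this
      omega
    · have := hmin ([x, y, z, x'] ::ₘ [y', z'] ::ₘ C, T', G) ⟨⟨by
        intro l hl
        simp only [Multiset.mem_cons] at hl
        rcases hl with rfl | rfl | hl
        · exact o_good4 ht.1 ht.2.1 ht.2.2.1 ht.2.2.2 hadj
        · exact o_good2 ht'.1 ht'.2.1 ht'.2.2.2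
        · exact hst.hC l hl, fun t h => hst'.hT t (by simp [h]), by
        rw [← hst'.hS]
        simp only [Multiset.map_cons, Multiset.sum_cons]
        simp only [← Multiset.cons_coe, ← Multiset.singleton_add, Multiset.insert_eq_cons,
          Multiset.coe_nil]
        abel⟩, hG⟩
      rw [hTT] at this
      simp only [Multiset.card_cons] at this
      omega
  have t1 := hst.hT (r, A, B) (by simp)
  have t2 := hst.hT (s, A', B') (by simp)
  dsimp only at t1 t2
  -- pieces
  have hpiece : ∀ l ∈ C, 3 * (Multiset.countP (H.Adj B) (l : Multiset V) +
      Multiset.countP (H.Adj B') (l : Multiset V)) ≤ 4 * Multiset.card (l : Multiset V) := by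
    intro l hl
    have hl' := hst.hC l hl
    obtain ⟨C', rfl⟩ := Multiset.exists_cons_of_mem hl
    refine o_piece H N r A B s A' B' t1.1 t1.2.1 t2.1 t2.2.1 t1.2.2.1 t1.2.2.2 t2.2.2.1 t2.2.2.2
      l hl'.1 hl'.2 ?_
    intro D hD hsum
    have := hmin ((D : Multiset (List V)) + C', T2, G) ⟨⟨by
      intro x hx
      rcases Multiset.mem_add.1 hx with hx | hx
      · exact hD x (by simpa using hx)
      · exact hst.hC x (by simp [hx]), fun t h => hst.hT t (by simp [h]), by
      rw [← hst.hS]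
      simp only [Multiset.map_cons, Multiset.sum_cons, Multiset.map_add, Multiset.sum_add,
        Multiset.map_coe, Multiset.sum_coe, hsum]
      abel⟩, hG⟩
    simp only [Multiset.card_cons] at this
    omega
  have htrip : ∀ t ∈ T2, 3 * (Multiset.countP (H.Adj B) ({t.1, t.2.1, t.2.2} : Multiset V) +
      Multiset.countP (H.Adj B') ({t.1, t.2.1, t.2.2} : Multiset V)) ≤
      2 * Multiset.card ({t.1, t.2.1, t.2.2} : Multiset V) := by
    intro t ht
    obtain ⟨T', rfl⟩ := Multiset.exists_cons_of_mem ht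
    have p1 := hpair (r, A, B) t ((s, A', B') ::ₘ T') (by rw [Multiset.cons_swap t])
    have p2 := hpair (s, A', B') t ((r, A, B) ::ₘ T')
      (by rw [Multiset.cons_swap (r, A, B), Multiset.cons_swap t])
    dsimp only at p1 p2
    simp only [Multiset.insert_eq_cons, ← Multiset.cons_zero, Multiset.countP_cons,
      Multiset.card_cons, Multiset.countP_zero, Multiset.card_zero, p1.1, p1.2, p2.1, p2.2,
      if_false]
    split_ifs <;> omega
  have b1 := o_count_bound _ _ _ _ _ C hpiece
  have b2 := o_count_bound _ _ _ _ _ T2 htrip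
  have c2 := o_card_const (fun t : V × V × V => ({t.1, t.2.1, t.2.2} : Multiset V)) 3 T2 (by simp)
  have p1 := hpair (r, A, B) (s, A', B') T2 rfl
  have p2 := hpair (s, A', B') (r, A, B) T2 (Multiset.cons_swap _ _ _)
  dsimp only at p1 p2
  have z1 : Multiset.countP (H.Adj B) G = 0 :=
    Multiset.countP_eq_zero.2 (hgar (r, A, B) _ rfl)
  have z2 : Multiset.countP (H.Adj B') G = 0 :=
    Multiset.countP_eq_zero.2 (hgar (s, A', B') ((r, A, B) ::ₘ T2) (Multiset.cons_swap _ _ _))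
  have e1 := hk B
  have e2 := hk B'
  have e3 : Multiset.card (Finset.univ : Finset V).val = Fintype.card V := rfl
  rw [← hst.hS] at e1 e2 e3
  simp only [Multiset.map_cons, Multiset.sum_cons] at e1 e2 e3
  simp only [Multiset.countP_add, Multiset.card_add, Multiset.insert_eq_cons, ← Multiset.cons_zero,
    Multiset.countP_cons, Multiset.card_cons, Multiset.countP_zero, Multiset.card_zero, z1, z2,
    p1.1, p1.2, p2.1, p2.2, SimpleGraph.irrefl, if_false] at e1 e2 e3 b1 b2 c2 ⊢
  have w0 : ∀ p : Prop, ∀ [Decidable p], (if p then 1 else 0) ≤ 1 := by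
    intro p _
    split_ifs <;> omega
  have w1 := w0 (H.Adj B r)
  have w2 := w0 (H.Adj B A)
  have w3 := w0 (H.Adj B A')
  have w4 := w0 (H.Adj B' s)
  have w5 := w0 (H.Adj B' A)
  have w6 := w0 (H.Adj B' A')
  linarith

lemma o_finish {V : Type*} [Fintype V] [DecidableEq V] (H : SimpleGraph V)
    (N : Finset V) (D : Multiset (List V)) (Y : Multiset V)
    (hD : ∀ l ∈ D, l.IsChain H.Adj ∧ OutGood (↑N) l)
    (hS : (D.map (fun l : List V => (l : Multiset V))).sum + Y = Finset.univ.val) :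
    ∃ P : Finset (List V),
        (∀ l ∈ P, l.IsChain H.Adj ∧ l.Nodup ∧ (∀ v ∈ l, v ∉ Y.toFinset) ∧
          OutGood (↑(N \ Y.toFinset)) l) ∧
        (∀ v : V, v ∉ Y.toFinset → ∃! l : List V, l ∈ P ∧ v ∈ l) := by
  have hcount : ∀ v, Multiset.count v (D.map (fun l : List V => (l : Multiset V))).sum +
      Multiset.count v Y = 1 := by
    intro v
    rw [← Multiset.count_add, hS]
    exact Multiset.count_eq_one_of_mem Finset.univ.nodup (Finset.mem_univ v)
  refine ⟨D.toFinset, ?_, ?_⟩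
  · intro l hl
    rw [Multiset.mem_toFinset] at hl
    obtain ⟨hch, hgood⟩ := hD l hl
    obtain ⟨D', rfl⟩ := Multiset.exists_cons_of_mem hl
    simp only [Multiset.map_cons, Multiset.sum_cons, Multiset.count_add,
      Multiset.coe_count] at hcount
    have hnot : ∀ v ∈ l, v ∉ Y.toFinset := by
      intro v hv hY
      have h1 := hcount v
      have h2 := List.count_pos_iff.2 hv
      have h3 := Multiset.count_pos.2 (Multiset.mem_toFinset.1 hY)
      omega
    refine ⟨hch, List.nodup_iff_count_le_one.2 (fun v => by have := hcount v; omega), hnot, ?_⟩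
    rcases hgood with ⟨a, b, rfl, ha, hb⟩ | ⟨a, b, c, d, rfl, hb, hc⟩ |
      ⟨a, b, c, d, e, f, rfl, hb, hc, hd, he⟩
    · refine Or.inl ⟨a, b, rfl, ?_, ?_⟩ <;> rw [Finset.mem_coe, Finset.mem_sdiff]
      · exact ⟨ha, hnot _ (by simp)⟩
      · exact ⟨hb, hnot _ (by simp)⟩
    · refine Or.inr (Or.inl ⟨a, b, c, d, rfl, ?_, ?_⟩) <;> rw [Finset.mem_coe, Finset.mem_sdiff]
      · exact ⟨hb, hnot _ (by simp)⟩
      · exact ⟨hc, hnot _ (by simp)⟩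
    · refine Or.inr (Or.inr ⟨a, b, c, d, e, f, rfl, ?_, ?_, ?_, ?_⟩) <;>
        rw [Finset.mem_coe, Finset.mem_sdiff]
      · exact ⟨hb, hnot _ (by simp)⟩
      · exact ⟨hc, hnot _ (by simp)⟩
      · exact ⟨hd, hnot _ (by simp)⟩
      · exact ⟨he, hnot _ (by simp)⟩
  · intro v hv
    have hv0 : Multiset.count v Y = 0 :=
      Multiset.count_eq_zero.2 (fun h => hv (Multiset.mem_toFinset.2 h))
    have hv1 : v ∈ (D.map (fun l : List V => (l : Multiset V))).sum := by
      rw [← Multiset.count_pos]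
      have := hcount v
      omega
    have hex : ∃ l ∈ D, v ∈ l := by
      clear hcount hS hD
      induction D using Multiset.induction with
      | empty => simp at hv1
      | cons a S ih =>
        simp only [Multiset.map_cons, Multiset.sum_cons, Multiset.mem_add, Multiset.mem_coe] at hv1
        rcases hv1 with h | h
        · exact ⟨a, by simp, h⟩
        · obtain ⟨l, h1, h2⟩ := ih h
          exact ⟨l, by simp [h1], h2⟩
    obtain ⟨l, hl, hvl⟩ := hex
    refine ⟨l, ⟨Multiset.mem_toFinset.2 hl, hvl⟩, ?_⟩
    rintro m ⟨hm, hvm⟩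
    rw [Multiset.mem_toFinset] at hm
    by_contra hne
    obtain ⟨D', rfl⟩ := Multiset.exists_cons_of_mem hl
    rcases Multiset.mem_cons.1 hm with h | h
    · exact hne h
    obtain ⟨D'', rfl⟩ := Multiset.exists_cons_of_mem h
    have h1 := hcount v
    simp only [Multiset.map_cons, Multiset.sum_cons, Multiset.count_add,
      Multiset.coe_count] at h1
    have h2 := List.count_pos_iff.2 hvl
    have h3 := List.count_pos_iff.2 hvm
    omega

lemma o_mem_sum {V α : Type*} (f : α → Multiset V) (S : Multiset α) (x : V) :
    x ∈ (S.map f).sum ↔ ∃ a ∈ S, x ∈ f a := by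
  induction S using Multiset.induction with
  | empty => simp
  | cons a S ih => simp [ih]

/-- Assemble an initial state. -/
lemma outgood_assemble {V : Type*} [Fintype V] [DecidableEq V] (H : SimpleGraph V) [DecidableRel H.Adj]
    (N : Finset V) (E0 : Multiset (V × V)) (hE0 : ∀ e ∈ E0, H.Adj e.1 e.2)
    (S : Multiset (List V)) (hS : ∀ l ∈ S, l.IsChain H.Adj ∧ OutGood (↑N) l)
    (W0 U : Multiset V) (k : ℕ)
    (hk : ∀ v ∈ W0, k ≤ Multiset.countP (H.Adj v)
      (E0.map (fun e => ({e.1, e.2} : Multiset V))).sum)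
    (hEN : ∀ v ∈ (E0.map (fun e => ({e.1, e.2} : Multiset V))).sum, v ∈ N)
    (hsum : (E0.map (fun e => ({e.1, e.2} : Multiset V))).sum + W0 + U +
      (S.map (fun l : List V => (l : Multiset V))).sum = Finset.univ.val) :
    ∃ (C : Multiset (List V)) (T : Multiset (V × V × V)) (G : Multiset V),
      OState H N C T G ∧
      ∃ w, G.card = U.card + w ∧ (w = 0 ∨ k + w ≤ W0.card) := by
  obtain ⟨E, T, F, W, hE, hT, hF, hA, hB, hW⟩ := o_stage2 H E0 hE0 W0 k hk
  rw [← hA] at hEN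
  refine ⟨E.map (fun e => [e.1, e.2]) + F.map (fun e => [e.1, e.2.1, e.2.2.1, e.2.2.2]) + S, T,
    U + W, ⟨?_, ?_, ?_⟩, W.card, by simp, hW⟩
  · intro l hl
    simp only [Multiset.mem_add, Multiset.mem_map] at hl
    rcases hl with (⟨e, he, rfl⟩ | ⟨e, he, rfl⟩) | hl
    · refine o_good2 (hEN _ ?_) (hEN _ ?_) (hE e he) <;>
        refine Multiset.mem_add.2 (Or.inl (Multiset.mem_add.2 (Or.inl ?_))) <;>
        exact (o_mem_sum _ _ _).2 ⟨e, he, by simp⟩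
    · refine o_good4 (hEN _ ?_) (hEN _ ?_) (hF e he).1 (hF e he).2.1 (hF e he).2.2 <;>
        refine Multiset.mem_add.2 (Or.inr ?_) <;>
        exact (o_mem_sum _ _ _).2 ⟨e, he, by simp⟩
    · exact hS l hl
  · intro e he
    refine ⟨hEN _ ?_, hEN _ ?_, hT e he⟩ <;>
        refine Multiset.mem_add.2 (Or.inl (Multiset.mem_add.2 (Or.inr ?_))) <;>
        exact (o_mem_sum _ _ _).2 ⟨e, he, by simp⟩
  · rw [← hsum, ← hA, ← hB]
    have f1 : (F.map (fun e => (([e.1, e.2.1, e.2.2.1, e.2.2.2] : List V) : Multiset V))).sum =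
        (F.map (fun e => ({e.2.1, e.2.2.1} : Multiset V))).sum +
        (F.map (fun e => ({e.1, e.2.2.2} : Multiset V))).sum := by
      rw [← Multiset.sum_map_add]
      congr 1
      refine Multiset.map_congr rfl (fun e _ => ?_)
      simp only [← Multiset.cons_coe, ← Multiset.singleton_add, Multiset.insert_eq_cons,
        Multiset.coe_nil]
      abel
    have f2 : (T.map (fun t => ({t.1, t.2.1, t.2.2} : Multiset V))).sum =
        (T.map (fun e => ({e.1} : Multiset V))).sum +
        (T.map (fun e => ({e.2.1, e.2.2} : Multiset V))).sum := by
      rw [← Multiset.sum_map_add]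
      congr 1
    have f3 : (E.map (fun e => (([e.1, e.2] : List V) : Multiset V))).sum =
        (E.map (fun e => ({e.1, e.2} : Multiset V))).sum := rfl
    simp only [Multiset.map_add, Multiset.sum_add, Multiset.map_map, Function.comp_def]
    rw [f1, f2, f3]
    abel

lemma o_start {V : Type*} [Fintype V] [DecidableEq V] (H : SimpleGraph V) [DecidableRel H.Adj]
    (N : Finset V) (y : ℝ) (hy : 0 ≤ y)
    (hδ : 2 / 3 * (Fintype.card V : ℝ) - y ≤ H.minDegree)
    (hn1 : 2 / 3 * (Fintype.card V : ℝ) - 2 * y ≤ N.card)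
    (hn2 : (N.card : ℝ) < 2 / 3 * (Fintype.card V : ℝ) - 2 * y + 1) :
    ∃ (C : Multiset (List V)) (T : Multiset (V × V × V)) (G : Multiset V),
      OState H N C T G ∧ (G.card : ℝ) ≤ 15 * y := by
  have hdeg : ∀ v, H.minDegree ≤ Multiset.countP (H.Adj v) (Finset.univ : Finset V).val := by
    intro v
    refine (H.minDegree_le_degree v).trans (le_of_eq ?_)
    rw [Multiset.countP_eq_card_filter, ← Finset.filter_val, Finset.card_val,
      ← SimpleGraph.card_neighborFinset_eq_degree, SimpleGraph.neighborFinset_eq_filter]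
  have hNR : N.val + Nᶜ.val = (Finset.univ : Finset V).val := by
    ext v
    rw [Multiset.count_add, Multiset.count_eq_one_of_mem Finset.univ.nodup (Finset.mem_univ v)]
    by_cases h : v ∈ N
    · rw [Multiset.count_eq_one_of_mem N.nodup h, Multiset.count_eq_zero.2 (by simpa using h)]
    · rw [Multiset.count_eq_zero.2 (by simpa using h),
        Multiset.count_eq_one_of_mem (Nᶜ).nodup (by simpa using h)]
  have hself : ∀ (A : Finset V) v, v ∈ A → Multiset.countP (H.Adj v) A.val + 1 ≤ A.card := by
    intro A v hv
    rw [Multiset.countP_eq_card_filter, ← Finset.filter_val, Finset.card_val]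
    refine Finset.card_lt_card (Finset.filter_ssubset.2 ⟨v, hv, by simp⟩)
  have hcard : N.card + (Nᶜ).card = Fintype.card V := Finset.card_add_card_compl N
  have hsplit : ∀ v, H.minDegree ≤ Multiset.countP (H.Adj v) N.val +
      Multiset.countP (H.Adj v) Nᶜ.val := by
    intro v
    rw [← Multiset.countP_add, hNR]
    exact hdeg v
  obtain ⟨M, U, hM, hMU, hU⟩ := o_stage1 H N.val (H.minDegree - (Nᶜ).card) (by
    intro v _
    have h1 := hsplit v
    have h2 := Multiset.countP_le_card (H.Adj v) Nᶜ.val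
    rw [Finset.card_val] at h2
    omega)
  rw [Finset.card_val] at hU
  have hMcard : 2 * M.card + U.card = N.card := by
    have h1 := o_card_const (fun e : V × V => ({e.1, e.2} : Multiset V)) 2 M (by simp)
    rw [← h1, ← Multiset.card_add, hMU, Finset.card_val]
  have hMN : ∀ v ∈ (M.map (fun e => ({e.1, e.2} : Multiset V))).sum, v ∈ N := by
    intro v hv
    rw [← Finset.mem_val, ← hMU]
    exact Multiset.mem_add.2 (Or.inl hv)
  have hcardR : (N.card : ℝ) + ((Nᶜ).card : ℝ) = Fintype.card V := by exact_mod_cast hcard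
  by_cases hsp : y < 1 / 15 ∧ N.card % 2 = 1
  · obtain ⟨hy15, hodd⟩ := hsp
    have i1 : 2 * Fintype.card V ≤ 3 * H.minDegree := by
      have : ((2 * Fintype.card V : ℕ) : ℝ) < ((3 * H.minDegree + 1 : ℕ) : ℝ) := by
        push_cast; linarith
      have := Nat.cast_lt.1 this
      omega
    have i2 : 2 * Fintype.card V ≤ 3 * N.card := by
      have : ((2 * Fintype.card V : ℕ) : ℝ) < ((3 * N.card + 1 : ℕ) : ℝ) := by
        push_cast; linarith
      have := Nat.cast_lt.1 this
      omega
    have i3 : 3 * N.card ≤ 2 * Fintype.card V + 2 := by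
      have : ((3 * N.card : ℕ) : ℝ) < ((2 * Fintype.card V + 3 : ℕ) : ℝ) := by
        push_cast; linarith
      have := Nat.cast_lt.1 this
      omega
    have hU1 : U.card = 1 := by omega
    obtain ⟨n0, rfl⟩ := Multiset.card_eq_one.1 hU1
    have hn0 : n0 ∈ N := by
      rw [← Finset.mem_val, ← hMU]; simp
    have j1 := hsplit n0
    have j2 := hself N n0 hn0
    have j3 := Multiset.countP_le_card (H.Adj n0) Nᶜ.val
    rw [Finset.card_val] at j3
    obtain ⟨r, hr, hnr⟩ := Multiset.countP_pos.1
      (by omega : 0 < Multiset.countP (H.Adj n0) Nᶜ.val)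
    obtain ⟨b, hb, hnb⟩ := Multiset.countP_pos.1
      (by omega : 0 < Multiset.countP (H.Adj n0) N.val)
    rw [← hMU, Multiset.mem_add, Multiset.mem_singleton] at hb
    rcases hb with hb | rfl
    swap
    · exact absurd hnb (H.irrefl)
    obtain ⟨⟨x, z⟩, hxz, hbxz⟩ := (o_mem_sum _ _ _).1 hb
    have hadj := hM _ hxz
    obtain ⟨M', rfl⟩ := Multiset.exists_cons_of_mem hxz
    obtain ⟨a, hab, hba⟩ : ∃ a, ({x, z} : Multiset V) = {b, a} ∧ H.Adj b a := by
      simp only [Multiset.insert_eq_cons, Multiset.mem_cons, Multiset.mem_singleton] at hbxz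
      rcases hbxz with rfl | rfl
      · exact ⟨z, rfl, hadj⟩
      · exact ⟨x, Multiset.pair_comm _ _, hadj.symm⟩
    simp only [Multiset.map_cons, Multiset.sum_cons, hab] at hMU hMN
    obtain ⟨R', hR'⟩ := Multiset.exists_cons_of_mem hr
    have hR'c : R'.card + 1 = (Nᶜ).card := by
      rw [← Finset.card_val, hR', Multiset.card_cons]
    obtain ⟨C, T, G, hst, w, hG, hw⟩ := outgood_assemble H N M' (fun e he => hM e (by simp [he]))
      {[r, n0, b, a]} (by
        intro l hl
        rw [Multiset.mem_singleton] at hl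
        subst hl
        exact o_good4 hn0 (hMN b (by simp)) hnr.symm hnb hba) R' 0 (H.minDegree - (Nᶜ).card - 2)
      (by
        intro v hv
        have h1 := hsplit v
        have h2 := hself Nᶜ v (by rw [← Finset.mem_val, hR']; simp [hv])
        rw [← hMU] at h1
        simp only [Multiset.countP_add] at h1
        have h3 := Multiset.countP_le_card (H.Adj v) {b, a}
        have h4 := Multiset.countP_le_card (H.Adj v) {n0}
        have h5 : Multiset.card ({b, a} : Multiset V) = 2 := Multiset.card_pair _ _
        have h6 : Multiset.card ({n0} : Multiset V) = 1 := Multiset.card_singleton _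
        omega)
      (fun v hv => hMN v (Multiset.mem_add.2 (Or.inr hv)))
      (by
        rw [← hNR, ← hMU, hR']
        simp only [Multiset.map_singleton, Multiset.sum_singleton]
        simp only [← Multiset.cons_coe, ← Multiset.singleton_add, Multiset.insert_eq_cons,
          Multiset.coe_nil]
        abel)
    refine ⟨C, T, G, hst, ?_⟩
    have : G.card = 0 := by
      rw [hG, Multiset.card_zero]
      omega
    rw [this]
    push_cast
    linarith
  · obtain ⟨C, T, G, hst, w, hG, hw⟩ := outgood_assemble H N M hM 0 (by simp) Nᶜ.val U
      (H.minDegree + 1 - (Nᶜ).card - U.card)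
      (by
        intro v hv
        have h1 := hsplit v
        have h2 := hself Nᶜ v hv
        rw [← hMU] at h1
        simp only [Multiset.countP_add] at h1
        have h3 := Multiset.countP_le_card (H.Adj v) U
        omega)
      hMN
      (by
        rw [← hNR, ← hMU]
        simp only [Multiset.map_zero, Multiset.sum_zero]
        abel)
    refine ⟨C, T, G, hst, ?_⟩
    rw [hG]
    rw [Finset.card_val] at hw
    have a1 : (U.card : ℝ) ≤ 4 * y ∨ U.card = 1 := by
      rcases hU with hU | hU
      · rcases Nat.le_one_iff_eq_zero_or_eq_one.1 hU with h | h
        · left; rw [h]; push_cast; linarith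
        · exact Or.inr h
      · left
        have : 2 * H.minDegree + U.card ≤ N.card + 2 * (Nᶜ).card := by omega
        have : (2 * H.minDegree + U.card : ℝ) ≤ N.card + 2 * (Nᶜ).card := by exact_mod_cast this
        linarith
    have a2 : w = 0 ∨ (w : ℝ) ≤ 5 * y - 1 + U.card := by
      rcases hw with hw | hw
      · exact Or.inl hw
      · right
        have : H.minDegree + 1 + w ≤ 2 * (Nᶜ).card + U.card := by omega
        have : (H.minDegree + 1 + w : ℝ) ≤ 2 * (Nᶜ).card + U.card := by exact_mod_cast this
        linarith
    push_cast
    by_cases hy15 : y < 1 / 15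
    · have heven : N.card % 2 = 0 := by
        by_contra h
        exact hsp ⟨hy15, by omega⟩
      have hU0 : U.card = 0 := by
        rcases a1 with h | h
        · have : (U.card : ℝ) < ((1 : ℕ) : ℝ) := by push_cast; linarith
          have := Nat.cast_lt.1 this
          omega
        · omega
      rw [hU0] at a2 ⊢
      rcases a2 with h | h
      · rw [h]; push_cast; linarith
      · push_cast at h ⊢; linarith
    · push Not at hy15
      rcases a1 with h | h
      · rcases a2 with h' | h'
        · rw [h']; push_cast; linarith
        · linarith
      · rw [h] at a2 ⊢
        rcases a2 with h' | h'
        · rw [h']; push_cast; linarith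
        · push_cast at h' ⊢
          by_cases hy10 : y < 1 / 10
          · have : (w : ℝ) < ((1 : ℕ) : ℝ) := by push_cast; linarith
            have := Nat.cast_lt.1 this
            have : w = 0 := by omega
            rw [this]; push_cast; linarith
          · linarith

theorem stmt_13 {V : Type*} [Fintype V] [DecidableEq V] (ξ : ℝ) (hξ0 : 0 < ξ) (hξ : ξ < 1/20)
    (H : SimpleGraph V) [DecidableRel H.Adj]
    (hmin : (2/3 - ξ) * (Fintype.card V : ℝ) ≤ (H.minDegree : ℝ))
    (N : Finset V) (hN : N.card = ⌈(2/3 - 2*ξ) * (Fintype.card V : ℝ)⌉₊) :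
    ∃ X : Finset V, (X.card : ℝ) ≤ (⌊15 * ξ * (Fintype.card V : ℝ)⌋ : ℝ) + 1 ∧
      ∃ P : Finset (List V),
        (∀ l ∈ P, l.Chain' H.Adj ∧ l.Nodup ∧ (∀ v ∈ l, v ∉ X) ∧ OutGood (↑(N \ X)) l) ∧
        (∀ v : V, v ∉ X → ∃! l : List V, l ∈ P ∧ v ∈ l) := by
  have hp0 : (0 : ℝ) ≤ Fintype.card V := Nat.cast_nonneg _
  have hy : 0 ≤ ξ * (Fintype.card V : ℝ) := by positivity
  have hnn : 0 ≤ (2/3 - 2*ξ) * (Fintype.card V : ℝ) :=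
    mul_nonneg (by linarith) hp0
  obtain ⟨C0, T0, G0, hst0, hG0⟩ := o_start H N (ξ * (Fintype.card V : ℝ)) hy
    (by linarith)
    (by
      have := Nat.le_ceil ((2/3 - 2*ξ) * (Fintype.card V : ℝ))
      rw [← hN] at this; linarith)
    (by
      have := Nat.ceil_lt_add_one hnn
      rw [← hN] at this; linarith)
  obtain ⟨C, T, G, hst, hG, hb⟩ := o_stage3 H N G0.card C0 T0 G0 hst0 le_rfl H.minDegree (by
    intro v
    refine (H.minDegree_le_degree v).trans (le_of_eq ?_)
    rw [Multiset.countP_eq_card_filter, ← Finset.filter_val, Finset.card_val,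
      ← SimpleGraph.card_neighborFinset_eq_degree, SimpleGraph.neighborFinset_eq_filter])
  have hfloor : ∀ m : ℕ, (m : ℝ) ≤ 15 * (ξ * (Fintype.card V : ℝ)) →
      (m : ℝ) ≤ (⌊15 * ξ * (Fintype.card V : ℝ)⌋ : ℝ) := by
    intro m hm
    have : (m : ℤ) ≤ ⌊15 * ξ * (Fintype.card V : ℝ)⌋ := by
      rw [Int.le_floor]; push_cast; linarith
    exact_mod_cast this
  have hGR : (G.card : ℝ) ≤ G0.card := by exact_mod_cast hG
  refine ⟨(G + T.map (fun t => t.1)).toFinset, ?_, ?_⟩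
  · have h1 : ((G + T.map (fun t => t.1)).toFinset.card : ℝ) ≤ G.card + T.card := by
      have := Multiset.toFinset_card_le (G + T.map (fun t => t.1))
      rw [Multiset.card_add, Multiset.card_map] at this
      exact_mod_cast this
    by_cases ht : T.card ≤ 1
    · have h2 := hfloor G.card (by linarith)
      have h3 : (T.card : ℝ) ≤ 1 := by exact_mod_cast ht
      linarith
    · have hb' := hb.resolve_left ht
      have h3 : (6 * H.minDegree + 6 * T.card + 4 * G.card : ℝ) ≤ 4 * Fintype.card V + 6 := by
        exact_mod_cast hb'
      have h4 : (2 : ℝ) ≤ T.card := by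
        have : 2 ≤ T.card := by omega
        exact_mod_cast this
      have h5 : (0 : ℝ) ≤ G.card := Nat.cast_nonneg _
      have h2 := hfloor (G.card + T.card) (by push_cast; linarith)
      push_cast at h2
      linarith
  · refine o_finish H N (C + T.map (fun t => [t.2.1, t.2.2])) (G + T.map (fun t => t.1)) ?_ ?_
    · intro l hl
      rcases Multiset.mem_add.1 hl with hl | hl
      · exact hst.hC l hl
      · obtain ⟨t, ht, rfl⟩ := Multiset.mem_map.1 hl
        have := hst.hT t ht
        exact o_good2 this.1 this.2.1 this.2.2.2
    · rw [← hst.hS]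
      have f2 : (T.map (fun t => ({t.1, t.2.1, t.2.2} : Multiset V))).sum =
          (T.map (fun e => ({e.1} : Multiset V))).sum +
          (T.map (fun e => (([e.2.1, e.2.2] : List V) : Multiset V))).sum := by
        rw [← Multiset.sum_map_add]
        congr 1
      have f3 : (T.map (fun e => ({e.1} : Multiset V))).sum = T.map (fun t => t.1) := by
        rw [← Multiset.sum_map_singleton (T.map (fun t => t.1)), Multiset.map_map]
        rfl
      rw [f2, f3]
      simp only [Multiset.map_add, Multiset.sum_add, Multiset.map_map, Function.comp_def]
      abel
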